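/- Let G be a finite connected simple graph on a vertex set V of n players with vertex degrees d_i = deg(i), and let O be a finite set of resources with |O| ≥ 2. Assign to each vertex, independently and uniformly at random, a resource from O, yielding a random allocation P. Then the expected total cost satisfies E[C(P)] ≤ n(2|O| − 1) + |O|(|O| − 1)·Σ_{i∈V} (1 − 1/|O|)^{d_i}. -/

import Mathlib

open Finset

noncomputable section

variable {V O : Type*} [Fintype V] [DecidableEq V] [Fintype O] [DecidableEq O]

/-- Diameter of the graph: maximum graph distance between any two vertices. -/
def csrDiam (G : SimpleGraph V) : ℕ :=
  Finset.sup Finset.univ fun i => Finset.sup Finset.univ fun j => G.dist i j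

/-- Distance from player `i` to the nearest holder of resource `o` under allocation `P`;
`csrDiam G + 1` if no one holds `o`. -/
def csrDist (G : SimpleGraph V) (P : V → O) (i : V) (o : O) : ℕ :=
  if h : (Finset.univ.filter fun j => P j = o).Nonempty then
    (Finset.univ.filter fun j => P j = o).inf' h fun j => G.dist i j
  else csrDiam G + 1

/-- Cost of player `i` under allocation `P`. -/
def csrCost (G : SimpleGraph V) (P : V → O) (i : V) : ℕ :=
  ∑ o ∈ Finset.univ.filter (fun o => o ≠ P i), csrDist G P i o

/-- Total cost of allocation `P`. -/
def csrTotal (G : SimpleGraph V) (P : V → O) : ℕ := ∑ i, csrCost G P i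

/-- Radius of player `i`: distance to nearest *other* player holding the same resource;
`csrDiam G` if there is none. -/
def csrRadius (G : SimpleGraph V) (P : V → O) (i : V) : ℕ :=
  if h : (Finset.univ.filter fun j => j ≠ i ∧ P j = P i).Nonempty then
    (Finset.univ.filter fun j => j ≠ i ∧ P j = P i).inf' h fun j => G.dist i j
  else csrDiam G

/-- Ball of radius `r` (a natural number) around `i`. -/
def csrBall (G : SimpleGraph V) (i : V) (r : ℕ) : Finset V :=
  Finset.univ.filter fun j => G.dist i j ≤ r

/-- Pure Nash equilibrium of the CSR game. -/
def csrIsNE (G : SimpleGraph V) (P : V → O) : Prop :=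
  ∀ (i : V) (o : O), csrCost G P i ≤ csrCost G (Function.update P i o) i

lemma aux_level (G : SimpleGraph V) (hconn : G.Connected) (u w : V) (t : ℕ)
    (ht : t ≤ G.dist u w) : ∃ x, G.dist u x = t := by
  obtain ⟨p, hp⟩ := hconn.exists_walk_length_eq_dist u w
  refine ⟨p.getVert t, ?_⟩
  have h1 := SimpleGraph.dist_le (p.take t)
  have h2 := SimpleGraph.dist_le (p.drop t)
  have h3 := hconn.dist_triangle (u := u) (v := p.getVert t) (w := w)
  rw [SimpleGraph.Walk.take_length] at h1
  rw [SimpleGraph.Walk.drop_length] at h2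
  omega

lemma aux_diam (G : SimpleGraph V) (i j : V) : G.dist i j ≤ csrDiam G :=
  (Finset.le_sup (f := fun j => G.dist i j) (mem_univ j)).trans
    (Finset.le_sup (f := fun i => Finset.sup Finset.univ fun j => G.dist i j) (mem_univ i))

lemma aux_attain (G : SimpleGraph V) (i : V) : ∃ u v, G.dist u v = csrDiam G := by
  obtain ⟨u, -, hu⟩ := Finset.exists_mem_eq_sup (Finset.univ : Finset V) ⟨i, mem_univ _⟩
    (fun i => Finset.sup Finset.univ fun j => G.dist i j)
  obtain ⟨v, -, hv⟩ := Finset.exists_mem_eq_sup (Finset.univ : Finset V) ⟨i, mem_univ _⟩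
    (fun j => G.dist u j)
  exact ⟨u, v, by unfold csrDiam; rw [hu, hv]⟩

lemma aux_nbhd (G : SimpleGraph V) [DecidableRel G.Adj] (i : V) :
    (insert i (G.neighborFinset i)).card = G.degree i + 1 := by
  rw [Finset.card_insert_of_notMem (by simp), SimpleGraph.card_neighborFinset_eq_degree]

/-- `n ≥ d + D - 1`. -/
lemma aux_n (G : SimpleGraph V) [DecidableRel G.Adj] (hconn : G.Connected) (i : V) :
    G.degree i + csrDiam G ≤ Fintype.card V + 1 := by
  obtain ⟨u, v, huv⟩ := aux_attain G i
  set N := insert i (G.neighborFinset i) with hN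
  have hsub : Finset.range (csrDiam G + 1) \ Finset.Icc (G.dist u i - 1) (G.dist u i + 1) ⊆
      (Finset.univ \ N).image (fun x => G.dist u x) := by
    intro t ht
    simp only [Finset.mem_sdiff, Finset.mem_range, Finset.mem_Icc] at ht
    obtain ⟨x, hx⟩ := aux_level G hconn u v t (by omega)
    refine Finset.mem_image.2 ⟨x, ?_, hx⟩
    simp only [Finset.mem_sdiff, Finset.mem_univ, true_and]
    intro hxN
    apply ht.2
    have hd : G.dist i x ≤ 1 := by
      rcases Finset.mem_insert.1 hxN with h | h
      · subst h; simp
      · rw [SimpleGraph.mem_neighborFinset] at h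
        exact (SimpleGraph.dist_eq_one_iff_adj.2 h).le
    have h1 := hconn.dist_triangle (u := u) (v := i) (w := x)
    have h2 := hconn.dist_triangle (u := u) (v := x) (w := i)
    rw [G.dist_comm (u := x) (v := i)] at h2
    omega
  have h1 := (Finset.card_le_card hsub).trans Finset.card_image_le
  have h2 := Finset.le_card_sdiff (Finset.Icc (G.dist u i - 1) (G.dist u i + 1))
    (Finset.range (csrDiam G + 1))
  have h3 := Finset.card_sdiff_add_card_eq_card (Finset.subset_univ N)
  rw [aux_nbhd, Finset.card_univ] at h3
  rw [Nat.card_Icc, Finset.card_range] at h2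
  omega

lemma aux_ball (G : SimpleGraph V) [DecidableRel G.Adj] (hconn : G.Connected) (i : V) (r : ℕ)
    (hr : r + 1 < csrDiam G) : G.degree i + (r + 1) ≤ (csrBall G i (r + 1)).card := by
  by_cases h : ∃ w, r + 1 < G.dist i w
  · obtain ⟨w, hw⟩ := h
    set N := insert i (G.neighborFinset i) with hN
    have hd : ∀ x ∈ N, G.dist i x ≤ 1 := by
      intro x hx
      rcases Finset.mem_insert.1 hx with h | h
      · subst h; simp
      · rw [SimpleGraph.mem_neighborFinset] at h
        exact (SimpleGraph.dist_eq_one_iff_adj.2 h).le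
    have hNB : N ⊆ csrBall G i (r + 1) := by
      intro x hx
      have := hd x hx
      simp only [csrBall, Finset.mem_filter, Finset.mem_univ, true_and]
      omega
    have hsub : Finset.Icc 2 (r + 1) ⊆
        (csrBall G i (r + 1) \ N).image (fun x => G.dist i x) := by
      intro t ht
      rw [Finset.mem_Icc] at ht
      obtain ⟨x, hx⟩ := aux_level G hconn i w t (by omega)
      refine Finset.mem_image.2 ⟨x, ?_, hx⟩
      simp only [Finset.mem_sdiff, csrBall, Finset.mem_filter, Finset.mem_univ, true_and]
      refine ⟨by omega, fun hxN => ?_⟩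
      have := hd x hxN
      omega
    have h1 := (Finset.card_le_card hsub).trans Finset.card_image_le
    have h3 := Finset.card_sdiff_add_card_eq_card hNB
    rw [aux_nbhd] at h3
    rw [Nat.card_Icc] at h1
    omega
  · push Not at h
    have : csrBall G i (r + 1) = Finset.univ := by
      ext x; simp [csrBall, h x]
    rw [this, Finset.card_univ]
    have := aux_n G hconn i
    omega

lemma aux_csrDist (G : SimpleGraph V) (P : V → O) (i : V) (o : O) :
    csrDist G P i o ≤ ∑ r ∈ Finset.range (csrDiam G + 1),
      if ∀ j ∈ csrBall G i r, P j ≠ o then 1 else 0 := by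
  rw [← Finset.card_filter]
  have key : Finset.range (csrDist G P i o) ⊆
      (Finset.range (csrDiam G + 1)).filter (fun r => ∀ j ∈ csrBall G i r, P j ≠ o) := by
    intro r hr
    rw [Finset.mem_range] at hr
    rw [Finset.mem_filter, Finset.mem_range]
    unfold csrDist at hr
    split_ifs at hr with h
    · rw [Finset.lt_inf'_iff] at hr
      refine ⟨?_, ?_⟩
      · obtain ⟨j, hj⟩ := h
        have := hr j hj
        have := aux_diam G i j
        omega
      · intro j hj hP
        have := hr j (by simp [hP])
        simp only [csrBall, Finset.mem_filter, Finset.mem_univ, true_and] at hj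
        omega
    · refine ⟨hr, fun j _ hP => h ⟨j, by simp [hP]⟩⟩
  simpa using Finset.card_le_card key

lemma aux_count (B : Finset V) (o : O) (hk : 0 < Fintype.card O) :
    (∑ P : V → O, if ∀ j ∈ B, P j ≠ o then (1 : ℝ) else 0) =
      (Fintype.card O : ℝ) ^ (Fintype.card V) * (1 - 1 / (Fintype.card O : ℝ)) ^ B.card := by
  have hk' : (Fintype.card O : ℝ) ≠ 0 := by positivity
  have h1 : ∀ P : V → O, (if ∀ j ∈ B, P j ≠ o then (1 : ℝ) else 0) =
      ∏ j, (if j ∈ B then (if P j ≠ o then (1 : ℝ) else 0) else 1) := by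
    intro P
    rw [Finset.prod_ite_mem, Finset.univ_inter, Finset.prod_ite_zero]
    simp
  simp_rw [h1]
  rw [← Fintype.piFinset_univ, ← Finset.prod_univ_sum (fun _ : V => (Finset.univ : Finset O))
    (fun j x => (if j ∈ B then (if x ≠ o then (1 : ℝ) else 0) else 1))]
  have h2 : ∀ j : V, (∑ x : O, (if j ∈ B then (if x ≠ o then (1 : ℝ) else 0) else 1)) =
      (Fintype.card O : ℝ) * (if j ∈ B then (1 - 1 / (Fintype.card O : ℝ)) else 1) := by
    intro j
    split_ifs with h
    · rw [← Finset.sum_filter, Finset.filter_ne', Finset.sum_const,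
        Finset.card_erase_of_mem (mem_univ _), Finset.card_univ, nsmul_eq_mul,
        Nat.cast_sub hk]
      field_simp
      simp
    · simp
  simp_rw [h2]
  rw [Finset.prod_mul_distrib, Finset.prod_ite_mem]
  simp

lemma aux_geom (k q : ℝ) (hq : k * q = k - 1) (hk : 2 ≤ k) (hq0 : 0 ≤ q) (m : ℕ) :
    (∑ r ∈ Finset.range m, q ^ (r + 1)) + q ^ m ≤ k - 1 := by
  have h : (∑ r ∈ Finset.range m, q ^ (r + 1)) + (k - 1) * q ^ m = k - 1 := by
    induction m with
    | zero => simp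
    | succ m ih =>
      rw [Finset.sum_range_succ, pow_succ]
      linear_combination ih + q ^ m * hq
  have : 0 ≤ q ^ m := by positivity
  nlinarith

lemma aux_sum (G : SimpleGraph V) [DecidableRel G.Adj] (hconn : G.Connected) (i : V)
    (k q : ℝ) (hq : k * q = k - 1) (hk : 2 ≤ k) (hq0 : 0 ≤ q) :
    ∑ r ∈ Finset.range (csrDiam G + 1), q ^ (csrBall G i r).card ≤
      q + (k - 1) * q ^ (G.degree i) := by
  have hq1 : q ≤ 1 := by nlinarith
  have h0 : q ^ (csrBall G i 0).card ≤ q := by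
    have : 0 < (csrBall G i 0).card := Finset.card_pos.2 ⟨i, by simp [csrBall]⟩
    exact pow_le_of_le_one hq0 hq1 this.ne'
  have hp : 0 ≤ q ^ (G.degree i) := by positivity
  rcases hD : csrDiam G with _ | m
  · simp only [zero_add, Finset.sum_range_one]
    nlinarith
  · rw [Finset.sum_range_succ', Finset.sum_range_succ]
    have h1 : ∑ r ∈ Finset.range m, q ^ (csrBall G i (r + 1)).card ≤
        ∑ r ∈ Finset.range m, q ^ (G.degree i) * q ^ (r + 1) := by
      refine Finset.sum_le_sum fun r hr => ?_
      rw [Finset.mem_range] at hr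
      rw [← pow_add]
      exact pow_le_pow_of_le_one hq0 hq1 (aux_ball G hconn i r (by omega))
    have h2 : q ^ (csrBall G i (m + 1)).card ≤ q ^ (G.degree i) * q ^ m := by
      rw [← pow_add]
      refine pow_le_pow_of_le_one hq0 hq1 ?_
      have : csrBall G i (m + 1) = Finset.univ := by
        ext x
        have := aux_diam G i x
        simp [csrBall]; omega
      rw [this, Finset.card_univ]
      have := aux_n G hconn i
      omega
    rw [← Finset.mul_sum] at h1
    have := mul_le_mul_of_nonneg_left (aux_geom k q hq hk hq0 m) hp
    linarith

/-- Under a uniformly random allocation (each vertex gets an independent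
uniform resource, i.e., all `|O|^n` allocations are equally likely), the expected total
cost is at most `n(2|O| - 1) + |O|(|O| - 1) Σ_i (1 - 1/|O|)^{deg i}`. -/
theorem stmt9 (G : SimpleGraph V) [DecidableRel G.Adj] (hconn : G.Connected)
    (hO2 : 2 ≤ Fintype.card O) :
    (∑ P : V → O, (csrTotal G P : ℝ)) / (Fintype.card O : ℝ) ^ (Fintype.card V) ≤
      (Fintype.card V : ℝ) * (2 * (Fintype.card O : ℝ) - 1) +
        (Fintype.card O : ℝ) * ((Fintype.card O : ℝ) - 1) *
          ∑ i : V, (1 - 1 / (Fintype.card O : ℝ)) ^ (G.degree i) := by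
  set k : ℝ := (Fintype.card O : ℝ) with hkdef
  have hk : 2 ≤ k := by rw [hkdef]; exact_mod_cast hO2
  have hk0 : 0 < k := by linarith
  set q : ℝ := 1 - 1 / k with hqdef
  have hq : k * q = k - 1 := by rw [hqdef]; field_simp
  have hq0 : 0 ≤ q := by
    by_contra h
    push Not at h
    nlinarith
  have hpt : ∀ P : V → O, (csrTotal G P : ℝ) ≤ ∑ i, ∑ o : O,
      ∑ r ∈ Finset.range (csrDiam G + 1),
        if ∀ j ∈ csrBall G i r, P j ≠ o then (1 : ℝ) else 0 := by
    intro P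
    have : csrTotal G P ≤ ∑ i, ∑ o : O,
      ∑ r ∈ Finset.range (csrDiam G + 1),
        if ∀ j ∈ csrBall G i r, P j ≠ o then 1 else 0 := by
      unfold csrTotal csrCost
      refine Finset.sum_le_sum fun i _ => ?_
      refine (Finset.sum_le_sum_of_subset (Finset.filter_subset _ _)).trans ?_
      exact Finset.sum_le_sum fun o _ => aux_csrDist G P i o
    exact_mod_cast this
  rw [div_le_iff₀ (by positivity)]
  have hn : 0 ≤ (Fintype.card V : ℝ) := by positivity
  calc (∑ P : V → O, (csrTotal G P : ℝ))
      ≤ ∑ P : V → O, ∑ i, ∑ o : O, ∑ r ∈ Finset.range (csrDiam G + 1),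
        (if ∀ j ∈ csrBall G i r, P j ≠ o then (1 : ℝ) else 0) :=
        Finset.sum_le_sum fun P _ => hpt P
    _ = ∑ i, ∑ o : O, ∑ r ∈ Finset.range (csrDiam G + 1),
        k ^ (Fintype.card V) * q ^ (csrBall G i r).card := by
        rw [Finset.sum_comm]
        refine Finset.sum_congr rfl fun i _ => ?_
        rw [Finset.sum_comm]
        refine Finset.sum_congr rfl fun o _ => ?_
        rw [Finset.sum_comm]
        refine Finset.sum_congr rfl fun r _ => ?_
        exact aux_count (csrBall G i r) o (by omega)
    _ ≤ ∑ i : V, ∑ _o : O, k ^ (Fintype.card V) * (q + (k - 1) * q ^ (G.degree i)) := by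
        refine Finset.sum_le_sum fun i _ => Finset.sum_le_sum fun o _ => ?_
        rw [← Finset.mul_sum]
        exact mul_le_mul_of_nonneg_left (aux_sum G hconn i k q hq hk hq0) (by positivity)
    _ = (Fintype.card V * (k - 1) + k * (k - 1) * ∑ i : V, q ^ (G.degree i)) *
          k ^ (Fintype.card V) := by
        simp only [Finset.sum_const, Finset.card_univ, nsmul_eq_mul, ← hkdef]
        rw [← Finset.mul_sum, ← Finset.mul_sum, Finset.sum_add_distrib, ← Finset.mul_sum,
          Finset.sum_const, Finset.card_univ, nsmul_eq_mul]
        linear_combination (Fintype.card V : ℝ) * k ^ (Fintype.card V) * hq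
    _ ≤ _ := by
        refine mul_le_mul_of_nonneg_right ?_ (by positivity)
        nlinarith
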